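/- For every p ≥ 3, the wedge product W_{p,1} = C_p ⋈ Δ_1 (a simple polytope of dimension 2 + p) admits a realization in R^{2+p} such that all faces of the subcomplex Σ_{p,4} ⊂ W_{p,1} are preserved by the projection to the first four coordinates, and moreover all faces of the projected surface lie on the lower hull of the projected 4-polytope, so that Σ_{p,4} is realized as a subcomplex of the boundary complex of a 4-polytope in R^4 and, by subsequent orthogonal projection, as an embedded polyhedral surface in R^3. -/

import Mathlib

open Matrix Set

noncomputable section

def setDim {V : Type*} [AddCommGroup V] [Module ℝ V] (s : Set V) : ℕ :=
  Module.finrank ℝ (affineSpan ℝ s).direction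

def IsFaceOf {V : Type*} [AddCommGroup V] [Module ℝ V] (F P : Set V) : Prop :=
  F ⊆ P ∧ ∃ (c : V →ₗ[ℝ] ℝ) (b : ℝ), (∀ x ∈ P, c x ≤ b) ∧ F = {x ∈ P | c x = b}

def IsVertexOf {V : Type*} [AddCommGroup V] [Module ℝ V] (v : V) (P : Set V) : Prop :=
  IsFaceOf {v} P

def IsFacetOf {V : Type*} [AddCommGroup V] [Module ℝ V] (F P : Set V) : Prop :=
  IsFaceOf F P ∧ F.Nonempty ∧ setDim F + 1 = setDim P


/-! ### Face lattices of polyhedra -/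

/-- The polyhedron cut out by the inequalities `f i z ≤ 1`. -/
def polyhedron {I V : Type*} [AddCommGroup V] [Module ℝ V] (f : I → V →ₗ[ℝ] ℝ) : Set V :=
  {z | ∀ i, f i z ≤ 1}

/-- The points of the polyhedron at which all the inequalities in `T` are tight. -/
def tightFace {I V : Type*} [AddCommGroup V] [Module ℝ V] (f : I → V →ₗ[ℝ] ℝ) (T : Set I) :
    Set V :=
  {z ∈ polyhedron f | ∀ i ∈ T, f i z = 1}

/-- The inequalities which are tight on all of `F`. -/
def tightIndices {I V : Type*} [AddCommGroup V] [Module ℝ V] (f : I → V →ₗ[ℝ] ℝ) (F : Set V) :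
    Set I :=
  {i | ∀ z ∈ F, f i z = 1}

/-- The sets of inequalities that are tight at some point of the polyhedron. -/
def activeSets {I V : Type*} [AddCommGroup V] [Module ℝ V] (f : I → V →ₗ[ℝ] ℝ) :
    Set (Set I) :=
  {T | ∃ z ∈ polyhedron f, T = {i | f i z = 1}}

theorem isFaceOf_tightFace {I V : Type*} [Finite I] [AddCommGroup V] [Module ℝ V]
    (f : I → V →ₗ[ℝ] ℝ) (T : Set I) : IsFaceOf (tightFace f T) (polyhedron f) := by
  classical
  have := Fintype.ofFinite I
  refine ⟨fun z hz => hz.1, ∑ i with i ∈ T, f i, ∑ i with i ∈ T, (1 : ℝ), ?_, ?_⟩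
  · intro z hz
    simp only [LinearMap.sum_apply]
    exact Finset.sum_le_sum fun i _ => hz i
  · ext z
    simp only [tightFace, mem_ofPred_eq, LinearMap.sum_apply]
    refine and_congr_right fun hz => ?_
    rw [Finset.sum_eq_sum_iff_of_le fun i _ => hz i]
    simp

theorem exists_tightIndices_eq {I V : Type*} [Finite I] [AddCommGroup V] [Module ℝ V]
    {f : I → V →ₗ[ℝ] ℝ} {F : Set V} (hF : IsFaceOf F (polyhedron f)) (hne : F.Nonempty) :
    ∃ z ∈ F, tightIndices f F = {i | f i z = 1} := by
  obtain ⟨hsub, c, b, hc, rfl⟩ := hF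
  obtain ⟨T, ⟨⟨z, hz, rfl⟩, hmin⟩⟩ :=
    ((Set.toFinite ((fun z => {i | f i z = 1}) '' {x ∈ polyhedron f | c x = b}))).exists_minimal
      (hne.image _)
  refine ⟨z, hz, Subset.antisymm (fun i hi => hi z hz) fun i hi w hw => ?_⟩
  have hP : ∀ j, f j ((1 / 2 : ℝ) • z + (1 / 2 : ℝ) • w) = f j z / 2 + f j w / 2 := by
    intro j
    simp only [map_add, map_smul, smul_eq_mul]
    ring
  have hmid : (1 / 2 : ℝ) • z + (1 / 2 : ℝ) • w ∈ {x ∈ polyhedron f | c x = b} := by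
    refine ⟨fun j => ?_, ?_⟩
    · rw [hP]
      linarith [hz.1 j, hw.1 j]
    · have h1 := hz.2
      have h2 := hw.2
      simp only [map_add, map_smul, smul_eq_mul]
      linarith
  have hle : ({j | f j ((1 / 2 : ℝ) • z + (1 / 2 : ℝ) • w) = 1} : Set I) ≤ {j | f j z = 1} := by
    intro j hj
    have h0 : f j ((1 / 2 : ℝ) • z + (1 / 2 : ℝ) • w) = 1 := hj
    rw [hP] at h0
    have h1 := hz.1 j
    have h2 := hw.1 j
    change f j z = 1
    linarith
  have h0 : f i ((1 / 2 : ℝ) • z + (1 / 2 : ℝ) • w) = 1 := hmin ⟨_, hmid, rfl⟩ hle hi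
  rw [hP] at h0
  have h1 : f i z = 1 := hi
  linarith

theorem tightFace_tightIndices {I V : Type*} [Finite I] [AddCommGroup V] [Module ℝ V]
    {f : I → V →ₗ[ℝ] ℝ} (huniv : univ ∉ activeSets f) {F : Set V}
    (hF : IsFaceOf F (polyhedron f)) : tightFace f (tightIndices f F) = F := by
  classical
  refine Subset.antisymm ?_ fun z hz => ⟨hF.1 hz, fun i hi => hi z hz⟩
  rcases F.eq_empty_or_nonempty with rfl | hne
  · rintro z ⟨hz, hz'⟩
    exact huniv ⟨z, hz, (eq_univ_of_forall fun i => hz' i (by simp [tightIndices])).symm⟩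
  obtain ⟨z₀, hz₀, hT⟩ := exists_tightIndices_eq hF hne
  rw [hT]
  rintro z ⟨hz, hz'⟩
  obtain ⟨hsub, c, b, hc, rfl⟩ := hF
  refine ⟨hz, le_antisymm (hc z hz) ?_⟩
  have hev : ∀ᶠ s : ℝ in nhdsWithin 0 (Ioi 0), ∀ i, f i z₀ + s * (f i z₀ - f i z) ≤ 1 := by
    rw [Filter.eventually_all]
    intro i
    by_cases hi : f i z₀ = 1
    · exact Filter.Eventually.of_forall fun s => by rw [hz' i hi, hi]; simp
    · have hlt : f i z₀ + (0 : ℝ) * (f i z₀ - f i z) < 1 := by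
        simpa using lt_of_le_of_ne (hz₀.1 i) hi
      have hcont : Continuous fun s : ℝ => f i z₀ + s * (f i z₀ - f i z) := by fun_prop
      filter_upwards [nhdsWithin_le_nhds (hcont.continuousAt.eventually_lt_const hlt)] with s hs
        using hs.le
  obtain ⟨s, hs, hs0⟩ := (hev.and self_mem_nhdsWithin).exists
  have hs0 : 0 < s := hs0
  have h1 := hc (z₀ + s • (z₀ - z)) fun i => by simpa using hs i
  have h2 : c z₀ = b := hz₀.2
  simp only [map_add, map_smul, map_sub, smul_eq_mul, h2] at h1
  nlinarith

theorem tightIndices_tightFace {I V : Type*} [AddCommGroup V] [Module ℝ V]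
    {f : I → V →ₗ[ℝ] ℝ} {T : Set I} (hT : T = univ ∨ T ∈ activeSets f) :
    tightIndices f (tightFace f T) = T := by
  refine Subset.antisymm ?_ fun i hi z hz => hz.2 i hi
  rcases hT with rfl | ⟨z, hz, rfl⟩
  · exact subset_univ _
  · exact fun i hi => hi z ⟨hz, fun _ h => h⟩

theorem tightIndices_eq_univ_or_mem {I V : Type*} [Finite I] [AddCommGroup V] [Module ℝ V]
    {f : I → V →ₗ[ℝ] ℝ} {F : Set V} (hF : IsFaceOf F (polyhedron f)) :
    tightIndices f F = univ ∨ tightIndices f F ∈ activeSets f := by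
  rcases F.eq_empty_or_nonempty with rfl | hne
  · exact Or.inl (eq_univ_of_forall fun i => by simp [tightIndices])
  · obtain ⟨z, hz, h⟩ := exists_tightIndices_eq hF hne
    exact Or.inr ⟨z, hF.1 hz, h⟩

theorem tightFace_anti {I V : Type*} [AddCommGroup V] [Module ℝ V] (f : I → V →ₗ[ℝ] ℝ)
    {S T : Set I} (h : S ⊆ T) : tightFace f T ⊆ tightFace f S :=
  fun _ hz => ⟨hz.1, fun i hi => hz.2 i (h hi)⟩

theorem tightIndices_anti {I V : Type*} [AddCommGroup V] [Module ℝ V] (f : I → V →ₗ[ℝ] ℝ)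
    {F G : Set V} (h : F ⊆ G) : tightIndices f G ⊆ tightIndices f F :=
  fun _ hi z hz => hi z (h hz)

/-- Polyhedra with the same active sets have isomorphic face lattices. -/
def faceIso {I V V' : Type*} [Finite I] [AddCommGroup V] [Module ℝ V]
    [AddCommGroup V'] [Module ℝ V'] (f : I → V →ₗ[ℝ] ℝ) (g : I → V' →ₗ[ℝ] ℝ)
    (h : activeSets f = activeSets g) (huniv : univ ∉ activeSets f) :
    {F // IsFaceOf F (polyhedron f)} ≃o {F // IsFaceOf F (polyhedron g)} where
  toFun F := ⟨tightFace g (tightIndices f F.1), isFaceOf_tightFace g _⟩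
  invFun F := ⟨tightFace f (tightIndices g F.1), isFaceOf_tightFace f _⟩
  left_inv F := Subtype.ext <| by
    change tightFace f (tightIndices g (tightFace g (tightIndices f F.1))) = F.1
    rw [tightIndices_tightFace (h ▸ tightIndices_eq_univ_or_mem F.2),
      tightFace_tightIndices huniv F.2]
  right_inv F := Subtype.ext <| by
    change tightFace g (tightIndices f (tightFace f (tightIndices g F.1))) = F.1
    rw [tightIndices_tightFace (h ▸ tightIndices_eq_univ_or_mem F.2),
      tightFace_tightIndices (h ▸ huniv) F.2]
  map_rel_iff' := by
    intro F G
    constructor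
    · intro hFG
      have h1 := tightFace_anti f (tightIndices_anti g (show
        tightFace g (tightIndices f F.1) ⊆ tightFace g (tightIndices f G.1) from hFG))
      rwa [tightIndices_tightFace (h ▸ tightIndices_eq_univ_or_mem F.2),
        tightIndices_tightFace (h ▸ tightIndices_eq_univ_or_mem G.2),
        tightFace_tightIndices huniv F.2, tightFace_tightIndices huniv G.2] at h1
    · intro hFG
      exact tightFace_anti g (tightIndices_anti f hFG)

/-- A linear map that has an affine inverse on `S` induces an isomorphism of face lattices. -/
def imageFaceIso {V U : Type*} [AddCommGroup V] [Module ℝ V] [AddCommGroup U] [Module ℝ U]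
    (π : V →ₗ[ℝ] U) (r : U →ₗ[ℝ] V) (S : Set V) (z₀ : V)
    (hr : ∀ z ∈ S, r (π z - π z₀) = z - z₀) :
    {X // IsFaceOf X S} ≃o {X // IsFaceOf X (π '' S)} := by
  have hinj : InjOn π S := fun z hz w hw h => by
    have h1 := hr z hz
    rw [h, hr w hw] at h1
    exact (sub_left_injective h1).symm
  refine
    { toFun := fun X => ⟨π '' X.1, ?_⟩
      invFun := fun Y => ⟨π ⁻¹' Y.1 ∩ S, ?_⟩
      left_inv := ?_
      right_inv := ?_
      map_rel_iff' := ?_ }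
  · obtain ⟨X, hsub, c, b, hc, hX⟩ := X
    refine ⟨image_mono hsub, c ∘ₗ r, b - c z₀ + c (r (π z₀)), ?_, ?_⟩
    · rintro _ ⟨z, hz, rfl⟩
      have h := congrArg c (hr z hz)
      simp only [map_sub] at h
      have := hc z hz
      simp only [LinearMap.comp_apply]
      linarith
    · ext y
      simp only [mem_image, mem_ofPred_eq]
      constructor
      · rintro ⟨z, hz, rfl⟩
        have h := congrArg c (hr z (hsub hz))
        simp only [map_sub] at h
        rw [hX] at hz
        have := hz.2
        refine ⟨⟨z, hz.1, rfl⟩, ?_⟩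
        simp only [LinearMap.comp_apply]
        linarith
      · rintro ⟨⟨z, hz, rfl⟩, hb⟩
        have h := congrArg c (hr z hz)
        simp only [map_sub] at h
        simp only [LinearMap.comp_apply] at hb
        refine ⟨z, ?_, rfl⟩
        rw [hX]
        exact ⟨hz, by linarith⟩
  · obtain ⟨Y, hsub, c, b, hc, hY⟩ := Y
    refine ⟨inter_subset_right, c ∘ₗ π, b, fun z hz => hc _ ⟨z, hz, rfl⟩, ?_⟩
    ext z
    simp only [mem_inter_iff, mem_preimage, hY, mem_ofPred_eq, LinearMap.comp_apply]
    exact ⟨fun h => ⟨h.2, h.1.2⟩, fun h => ⟨⟨⟨z, h.1, rfl⟩, h.2⟩, h.1⟩⟩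
  · intro X
    refine Subtype.ext (Subset.antisymm ?_ fun z hz => ⟨⟨z, hz, rfl⟩, X.2.1 hz⟩)
    rintro z ⟨⟨w, hw, hwz⟩, hz⟩
    rwa [← hinj (X.2.1 hw) hz hwz]
  · intro Y
    refine Subtype.ext (Subset.antisymm ?_ fun y hy => ?_)
    · rintro _ ⟨z, hz, rfl⟩
      exact hz.1
    · obtain ⟨z, hz, rfl⟩ := Y.2.1 hy
      exact ⟨z, ⟨hy, hz⟩, rfl⟩
  · intro X Y
    exact hinj.image_subset_image_iff X.2.1 Y.2.1

/-! ### Planar polygons given by affine inequalities -/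

/-- The affine function on the plane with coefficient vector `q`. -/
def affEval (q : Fin 3 → ℝ) (x : Fin 2 → ℝ) : ℝ :=
  q 0 * x 0 + q 1 * x 1 + q 2

theorem affEval_combo (q : Fin 3 → ℝ) (x y : Fin 2 → ℝ) (s : ℝ) :
    affEval q ((1 - s) • x + s • y) = (1 - s) * affEval q x + s * affEval q y := by
  simp [affEval]
  ring

/-- The determinant of the linear parts of two affine functions. -/
def det₂ (q r : Fin 3 → ℝ) : ℝ := q 0 * r 1 - q 1 * r 0

/-- The determinant of the coefficient vectors of three affine functions. -/
def det₃ (q r s : Fin 3 → ℝ) : ℝ :=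
  (q 1 * r 2 - q 2 * r 1) * s 0 + (q 2 * r 0 - q 0 * r 2) * s 1 + (q 0 * r 1 - q 1 * r 0) * s 2

theorem eq_of_affEval_eq {q r : Fin 3 → ℝ} (h : det₂ q r ≠ 0) {x y : Fin 2 → ℝ}
    (hq : affEval q x = affEval q y) (hr : affEval r x = affEval r y) : x = y := by
  simp only [affEval] at hq hr
  have h0 : det₂ q r * (x 0 - y 0) = 0 := by
    simp only [det₂]
    linear_combination r 1 * hq - q 1 * hr
  have h1 : det₂ q r * (x 1 - y 1) = 0 := by
    simp only [det₂]
    linear_combination q 0 * hr - r 0 * hq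
  ext l
  fin_cases l
  · exact sub_eq_zero.1 ((mul_eq_zero.1 h0).resolve_left h)
  · exact sub_eq_zero.1 ((mul_eq_zero.1 h1).resolve_left h)

/-- The inequalities `affEval (q i) x ≥ 0` define a `p`-gon with cyclically ordered edges. -/
def IsPolygonal {p : ℕ} (q : ZMod p → Fin 3 → ℝ) : Prop :=
  ∀ i, det₂ (q i) (q (i + 1)) ≠ 0 ∧ ∃ v, affEval (q i) v = 0 ∧ affEval (q (i + 1)) v = 0 ∧
    ∀ k, k ≠ i → k ≠ i + 1 → 0 < affEval (q k) v

/-- A set of edges of a `p`-gon containing a common point that lies on no other edge. -/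
def IsPolygonFlat {p : ℕ} (S : Set (ZMod p)) : Prop :=
  S = ∅ ∨ (∃ i, S = {i}) ∨ ∃ i, S = {i, i + 1}

theorem zmod_natCast_ne_zero {p n : ℕ} (hn : 0 < n) (hnp : n < p) : (n : ZMod p) ≠ 0 := by
  rw [Ne, ZMod.natCast_eq_zero_iff]
  exact Nat.not_dvd_of_pos_of_lt hn hnp

theorem zmod_one_ne_zero {p : ℕ} (hp : 3 ≤ p) : (1 : ZMod p) ≠ 0 := by
  simpa using zmod_natCast_ne_zero (p := p) (n := 1) one_pos (by omega)

theorem zmod_two_ne_zero {p : ℕ} (hp : 3 ≤ p) : (2 : ZMod p) ≠ 0 := by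
  simpa using zmod_natCast_ne_zero (p := p) (n := 2) two_pos (by omega)

theorem not_isPolygonFlat_univ {p : ℕ} (hp : 3 ≤ p) :
    ¬ IsPolygonFlat (univ : Set (ZMod p)) := by
  have h1 := zmod_one_ne_zero hp
  have h2 := zmod_two_ne_zero hp
  rintro (h | ⟨i, h⟩ | ⟨i, h⟩)
  · exact (h ▸ mem_univ (0 : ZMod p) : (0 : ZMod p) ∈ (∅ : Set (ZMod p)))
  · have h3 : i + 1 ∈ ({i} : Set (ZMod p)) := h ▸ mem_univ _
    simp_all
  · have h3 : i + 2 ∈ ({i, i + 1} : Set (ZMod p)) := h ▸ mem_univ _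
    rcases h3 with h3 | h3
    · simp_all
    · have h4 : (2 : ZMod p) = 1 := add_left_cancel h3
      exact h1 (by linear_combination h4)

/-- Stability of polygons under small changes of the coefficients. -/
theorem isOpen_setOf_isPolygonal {p : ℕ} [NeZero p] :
    IsOpen {q : ZMod p → Fin 3 → ℝ | IsPolygonal q} := by
  have : {q : ZMod p → Fin 3 → ℝ | IsPolygonal q} =
      {q | ∀ i, det₂ (q i) (q (i + 1)) ≠ 0 ∧ ∀ k, k ≠ i → k ≠ i + 1 →
        0 < det₂ (q i) (q (i + 1)) * det₃ (q i) (q (i + 1)) (q k)} := by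
    ext q
    refine forall_congr' fun i => and_congr_right fun hd => ?_
    have key : ∀ (v : Fin 2 → ℝ) (k : ZMod p), affEval (q i) v = 0 → affEval (q (i + 1)) v = 0 →
        det₂ (q i) (q (i + 1)) * affEval (q k) v = det₃ (q i) (q (i + 1)) (q k) := by
      intro v k h1 h2
      simp only [affEval, det₂, det₃] at *
      linear_combination (q (i + 1) 1 * q k 0 - q (i + 1) 0 * q k 1) * h1 +
        (q i 0 * q k 1 - q i 1 * q k 0) * h2
    constructor
    · rintro ⟨v, h1, h2, h3⟩ k hk hk'
      rw [← key v k h1 h2, ← mul_assoc]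
      exact mul_pos (mul_self_pos.2 hd) (h3 k hk hk')
    · intro h
      obtain ⟨v, hv⟩ : ∃ v : Fin 2 → ℝ, v =
          ![(q i 1 * q (i + 1) 2 - q i 2 * q (i + 1) 1) / det₂ (q i) (q (i + 1)),
            (q i 2 * q (i + 1) 0 - q i 0 * q (i + 1) 2) / det₂ (q i) (q (i + 1))] := ⟨_, rfl⟩
      have h1 : affEval (q i) v = 0 := by
        simp only [affEval, hv, Matrix.cons_val_zero, Matrix.cons_val_one]
        field_simp
        simp only [det₂]
        ring
      have h2 : affEval (q (i + 1)) v = 0 := by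
        simp only [affEval, hv, Matrix.cons_val_zero, Matrix.cons_val_one]
        field_simp
        simp only [det₂]
        ring
      refine ⟨v, h1, h2, fun k hk hk' => ?_⟩
      have h3 := h k hk hk'
      rw [← key v k h1 h2, ← mul_assoc] at h3
      exact pos_of_mul_pos_right h3 (mul_self_nonneg _)
  rw [this]
  simp only [Set.ofPred_forall, Set.ofPred_and]
  refine isOpen_iInter_of_finite fun i => IsOpen.inter ?_ ?_
  · refine isOpen_ne_fun ?_ continuous_const
    unfold det₂
    fun_prop
  · refine isOpen_iInter_of_finite fun k => isOpen_iInter_of_finite fun _ =>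
      isOpen_iInter_of_finite fun _ => isOpen_lt continuous_const ?_
    unfold det₂ det₃
    fun_prop

theorem IsPolygonal.isPolygonFlat {p : ℕ} (hp : 3 ≤ p) {q : ZMod p → Fin 3 → ℝ}
    (hq : IsPolygonal q) {x : Fin 2 → ℝ} (hx : ∀ k, 0 ≤ affEval (q k) x) :
    IsPolygonFlat {k | affEval (q k) x = 0} := by
  have h1 := zmod_one_ne_zero hp
  have h2 := zmod_two_ne_zero hp
  rcases eq_empty_or_nonempty {k | affEval (q k) x = 0} with h | ⟨i, hi⟩
  · exact Or.inl h
  have hi : affEval (q i) x = 0 := hi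
  obtain ⟨hd, v, hv, hv', hpos⟩ := hq i
  obtain ⟨-, w, hw', hw, hpos'⟩ := hq (i - 1)
  rw [sub_add_cancel] at hw hpos'
  have e1 : i + 1 ≠ i := by simpa using h1
  have e2 : i + 1 ≠ i - 1 := fun h => h2 (by linear_combination h)
  have e3 : i - 1 ≠ i := by simpa using h1
  have hA := hpos' (i + 1) e2 e1
  have hB := hpos (i - 1) e3 e2.symm
  obtain ⟨s, hs⟩ : ∃ s, s = affEval (q (i + 1)) x / affEval (q (i + 1)) w := ⟨_, rfl⟩
  have hs0 : 0 ≤ s := hs ▸ div_nonneg (hx _) hA.le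
  have hxe : x = (1 - s) • v + s • w := by
    refine eq_of_affEval_eq hd ?_ ?_
    · rw [affEval_combo, hi, hv, hw]
      ring
    · rw [affEval_combo, hv', hs]
      field_simp
      ring
  have hs1 : s ≤ 1 := by
    have h3 := hx (i - 1)
    rw [hxe, affEval_combo, hw'] at h3
    nlinarith
  have hoth : ∀ k, k ≠ i → k ≠ i + 1 → k ≠ i - 1 → 0 < affEval (q k) x := by
    intro k hk hk' hk''
    rw [hxe, affEval_combo]
    have h3 := hpos k hk hk'
    have h4 := hpos' k hk'' hk
    rcases hs0.eq_or_lt with rfl | hs0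
    · simpa using h3
    · have := mul_pos hs0 h4
      have := mul_nonneg (sub_nonneg.2 hs1) h3.le
      linarith
  have hnext : affEval (q (i + 1)) x = 0 ↔ s = 0 := by
    rw [hxe, affEval_combo, hv']
    simp [hA.ne']
  have hprev : affEval (q (i - 1)) x = 0 ↔ s = 1 := by
    rw [hxe, affEval_combo, hw']
    simp only [mul_zero, add_zero, mul_eq_zero, hB.ne', or_false, sub_eq_zero]
    exact eq_comm
  have hmem : ∀ k, affEval (q k) x = 0 ↔ k = i ∨ (k = i + 1 ∧ s = 0) ∨ (k = i - 1 ∧ s = 1) := by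
    intro k
    constructor
    · intro hk
      by_contra! hcon
      obtain ⟨c1, c2, c3⟩ := hcon
      refine (hoth k c1 ?_ ?_).ne' hk
      · rintro rfl
        exact c2 rfl (hnext.1 hk)
      · rintro rfl
        exact c3 rfl (hprev.1 hk)
    · rintro (rfl | ⟨rfl, h⟩ | ⟨rfl, h⟩)
      · exact hi
      · exact hnext.2 h
      · exact hprev.2 h
  refine Or.inr ?_
  by_cases c0 : s = 0
  · refine Or.inr ⟨i, ?_⟩
    ext k
    simp [hmem, c0]
  · by_cases c1 : s = 1
    · refine Or.inr ⟨i - 1, ?_⟩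
      ext k
      simp [hmem, c1, or_comm]
    · refine Or.inl ⟨i, ?_⟩
      ext k
      simp [hmem, c0, c1]

theorem IsPolygonal.exists_of_isPolygonFlat {p : ℕ} [NeZero p] (hp : 3 ≤ p)
    {q : ZMod p → Fin 3 → ℝ}
    (hq : IsPolygonal q) {S : Set (ZMod p)} (hS : IsPolygonFlat S) :
    ∃ x, (∀ k, 0 ≤ affEval (q k) x) ∧ ∀ k, affEval (q k) x = 0 ↔ k ∈ S := by
  have h1 := zmod_one_ne_zero hp
  have h2 := zmod_two_ne_zero hp
  have hvert : ∀ i, ∃ x, (∀ k, 0 ≤ affEval (q k) x) ∧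
      ∀ k, affEval (q k) x = 0 ↔ k ∈ ({i, i + 1} : Set (ZMod p)) := by
    intro i
    obtain ⟨-, v, hv, hv', hpos⟩ := hq i
    have hzero : ∀ k, k ∈ ({i, i + 1} : Set (ZMod p)) → affEval (q k) v = 0 := by
      rintro k (rfl | rfl)
      · exact hv
      · exact hv'
    have hpos' : ∀ k, k ∉ ({i, i + 1} : Set (ZMod p)) → 0 < affEval (q k) v := by
      intro k hk
      simp only [mem_insert_iff, mem_singleton_iff, not_or] at hk
      exact hpos k hk.1 hk.2
    refine ⟨v, fun k => ?_, fun k => ⟨fun h => ?_, hzero k⟩⟩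
    · by_cases hk : k ∈ ({i, i + 1} : Set (ZMod p))
      · exact (hzero k hk).ge
      · exact (hpos' k hk).le
    · by_contra hk
      exact (hpos' k hk).ne' h
  have hmid : ∀ {x y : Fin 2 → ℝ} {S T : Set (ZMod p)},
      ((∀ k, 0 ≤ affEval (q k) x) ∧ ∀ k, affEval (q k) x = 0 ↔ k ∈ S) →
      ((∀ k, 0 ≤ affEval (q k) y) ∧ ∀ k, affEval (q k) y = 0 ↔ k ∈ T) →
      ∃ z, (∀ k, 0 ≤ affEval (q k) z) ∧ ∀ k, affEval (q k) z = 0 ↔ k ∈ S ∩ T := by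
    rintro x y S T ⟨hx, hx'⟩ ⟨hy, hy'⟩
    refine ⟨(1 - (1 / 2 : ℝ)) • x + (1 / 2 : ℝ) • y, fun k => ?_, fun k => ?_⟩
    · rw [affEval_combo]
      linarith [hx k, hy k]
    · rw [affEval_combo, mem_inter_iff, ← hx', ← hy']
      have := hx k
      have := hy k
      constructor
      · intro h
        constructor <;> linarith
      · rintro ⟨h, h'⟩
        rw [h, h']
        ring
  have hedge : ∀ i, ∃ x, (∀ k, 0 ≤ affEval (q k) x) ∧
      ∀ k, affEval (q k) x = 0 ↔ k ∈ ({i} : Set (ZMod p)) := by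
    intro i
    obtain ⟨x, hx⟩ := hvert i
    obtain ⟨y, hy⟩ := hvert (i - 1)
    obtain ⟨z, hz, hz'⟩ := hmid hx hy
    refine ⟨z, hz, fun k => ?_⟩
    rw [hz']
    simp only [sub_add_cancel, mem_inter_iff, mem_insert_iff, mem_singleton_iff]
    constructor
    · rintro ⟨rfl | rfl, h | h⟩
      · rfl
      · rfl
      · exact absurd (by linear_combination h) h2
      · exact h
    · rintro rfl
      exact ⟨Or.inl rfl, Or.inr rfl⟩
  rcases hS with rfl | ⟨i, rfl⟩ | ⟨i, rfl⟩
  · obtain ⟨x, hx⟩ := hedge 0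
    obtain ⟨y, hy⟩ := hedge 1
    obtain ⟨z, hz, hz'⟩ := hmid hx hy
    refine ⟨z, hz, fun k => ?_⟩
    rw [hz']
    simp only [mem_inter_iff, mem_singleton_iff, mem_empty_iff_false, iff_false]
    rintro ⟨rfl, h⟩
    exact h1 h.symm
  · exact hedge i
  · exact hvert i

/-- The coefficient vector of the affine function `x ↦ 1 - a ⬝ᵥ x`. -/
def slackCoeff (a : Fin 2 → ℝ) : Fin 3 → ℝ := ![-a 0, -a 1, 1]

theorem affEval_slackCoeff (a x : Fin 2 → ℝ) : affEval (slackCoeff a) x = 1 - a ⬝ᵥ x := by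
  simp [affEval, slackCoeff, dotProduct, Fin.sum_univ_two]
  ring

theorem eq_of_det₂_eq_zero {a a' v : Fin 2 → ℝ} (hd : a 0 * a' 1 - a 1 * a' 0 = 0)
    (h : a ⬝ᵥ v = 1) (h' : a' ⬝ᵥ v = 1) : a = a' := by
  simp only [dotProduct, Fin.sum_univ_two] at h h'
  ext l
  fin_cases l
  · change a 0 = a' 0
    linear_combination a' 0 * h - a 0 * h' + v 1 * hd
  · change a 1 = a' 1
    linear_combination a' 1 * h - a 1 * h' - v 0 * hd

theorem isPolygonal_slackCoeff {p : ℕ} (hp : 3 ≤ p) (a : ZMod p → Fin 2 → ℝ)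
    (C : Set (Fin 2 → ℝ)) (hC : C = {x | ∀ i, a i ⬝ᵥ x ≤ 1})
    (hCbd : Bornology.IsBounded C) (hCdim : setDim C = 2)
    (hCinj : Function.Injective fun i => {x ∈ C | a i ⬝ᵥ x = 1})
    (hCcyc : ∀ i i' : ZMod p,
      (∃ v, {x ∈ C | a i ⬝ᵥ x = 1} ∩ {x ∈ C | a i' ⬝ᵥ x = 1} = {v}) ↔
        (i' = i + 1 ∨ i = i' + 1)) :
    IsPolygonal fun i => slackCoeff (a i) := by
  have h1 := zmod_one_ne_zero hp
  have h2 := zmod_two_ne_zero hp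
  have hainj : Function.Injective a := fun i j h => hCinj (by simp [h])
  have hdet : ∀ i j v, i ≠ j → a i ⬝ᵥ v = 1 → a j ⬝ᵥ v = 1 →
      a i 0 * a j 1 - a i 1 * a j 0 ≠ 0 := fun i j v hij hi hj hd =>
    hij (hainj (eq_of_det₂_eq_zero hd hi hj))
  have hadj : ∀ i j v, i ≠ j → v ∈ C → a i ⬝ᵥ v = 1 → a j ⬝ᵥ v = 1 →
      j = i + 1 ∨ i = j + 1 := by
    intro i j v hij hv hi hj
    refine (hCcyc i j).1 ⟨v, ?_⟩
    refine Subset.antisymm ?_ ?_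
    · rintro w ⟨⟨hw, hwi⟩, -, hwj⟩
      refine eq_of_affEval_eq (q := slackCoeff (a i)) (r := slackCoeff (a j)) ?_ ?_ ?_
      · simpa [det₂, slackCoeff] using hdet i j v hij hi hj
      · rw [affEval_slackCoeff, affEval_slackCoeff, hwi, hi]
      · rw [affEval_slackCoeff, affEval_slackCoeff, hwj, hj]
    · rintro w rfl
      exact ⟨⟨hv, hi⟩, hv, hj⟩
  intro i
  obtain ⟨v, hv⟩ := (hCcyc i (i + 1)).2 (Or.inl rfl)
  obtain ⟨⟨hvC, hvi⟩, -, hvi'⟩ : v ∈ {x ∈ C | a i ⬝ᵥ x = 1} ∩ {x ∈ C | a (i + 1) ⬝ᵥ x = 1} :=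
    hv ▸ mem_singleton v
  have hne : i ≠ i + 1 := by simpa using h1
  refine ⟨by simpa [det₂, slackCoeff] using hdet i (i + 1) v hne hvi hvi', v, ?_, ?_, ?_⟩
  · rw [affEval_slackCoeff, hvi, sub_self]
  · rw [affEval_slackCoeff, hvi', sub_self]
  intro k hk hk'
  rw [affEval_slackCoeff, sub_pos]
  have hvC' : ∀ i, a i ⬝ᵥ v ≤ 1 := by rwa [hC] at hvC
  refine lt_of_le_of_ne (hvC' k) fun hvk => ?_
  have hki : i = k + 1 := (hadj i k v hk.symm hvC hvi hvk).resolve_left hk'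
  have hki' : k = i + 1 + 1 :=
    (hadj (i + 1) k v hk'.symm hvC hvi' hvk).resolve_right fun h => hk (add_right_cancel h).symm
  have h3 : ((3 : ℕ) : ZMod p) = 0 := by
    push_cast
    linear_combination -hki - hki'
  obtain rfl : p = 3 :=
    le_antisymm (Nat.le_of_dvd (by norm_num) ((ZMod.natCast_eq_zero_iff 3 p).1 h3)) hp
  have hall : ∀ j, a j ⬝ᵥ v = 1 := by
    intro j
    have : ∀ i j : ZMod 3, j = i ∨ j = i + 1 ∨ j = i + 1 + 1 := by decide
    rcases this i j with rfl | rfl | rfl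
    · exact hvi
    · exact hvi'
    · exact hki' ▸ hvk
  obtain ⟨w, hw, hwv⟩ : ∃ w ∈ C, w ≠ v := by
    by_contra! hcon
    have hs : C = {v} := Subset.antisymm (fun w hw => hcon w hw) (by rintro w rfl; exact hvC)
    rw [hs, setDim, direction_affineSpan, vectorSpan_singleton] at hCdim
    simp at hCdim
  have hray : ∀ s : ℝ, 0 ≤ s → v + s • (w - v) ∈ C := by
    intro s hs
    rw [hC] at hw ⊢
    intro j
    have h4 : a j ⬝ᵥ w ≤ 1 := hw j
    rw [dotProduct_add, dotProduct_smul, dotProduct_sub, hall j, smul_eq_mul]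
    nlinarith
  obtain ⟨R, hR⟩ := hCbd.exists_norm_le
  have hwv' : 0 < ‖w - v‖ := norm_pos_iff.2 (sub_ne_zero.2 hwv)
  have hR0 : 0 ≤ R := (norm_nonneg _).trans (hR v hvC)
  have h5 := hR _ (hray ((R + ‖v‖ + 1) / ‖w - v‖) (by positivity))
  have h6 : ‖((R + ‖v‖ + 1) / ‖w - v‖) • (w - v)‖ = R + ‖v‖ + 1 := by
    rw [norm_smul, Real.norm_of_nonneg (by positivity)]
    field_simp
  have h7 := norm_sub_le (v + ((R + ‖v‖ + 1) / ‖w - v‖) • (w - v)) v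
  rw [add_sub_cancel_left, h6] at h7
  linarith

theorem mul_neg_of_isBounded_segment (b : ZMod 2 → Fin 1 → ℝ)
    (hbd : Bornology.IsBounded {y : Fin 1 → ℝ | ∀ j, b j ⬝ᵥ y ≤ 1}) : b 0 0 * b 1 0 < 0 := by
  by_contra! hcon
  obtain ⟨R, hR⟩ := hbd.exists_norm_le
  obtain ⟨s, hs, h0, h1⟩ : ∃ s : ℝ, |s| = 1 ∧ b 0 0 * s ≤ 0 ∧ b 1 0 * s ≤ 0 := by
    rcases nonneg_and_nonneg_or_nonpos_and_nonpos_of_mul_nonneg hcon with h | h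
    · exact ⟨-1, by simp, by linarith [h.1], by linarith [h.2]⟩
    · exact ⟨1, by simp, by linarith [h.1], by linarith [h.2]⟩
  have h2 := hR (fun _ => (|R| + 1) * s) fun j => by
    have hR := abs_nonneg R
    simp only [dotProduct, Finset.univ_unique, Fin.default_eq_zero, Finset.sum_singleton]
    have hj : b j 0 * s ≤ 0 := by
      have : ∀ j : ZMod 2, j = 0 ∨ j = 1 := by decide
      rcases this j with rfl | rfl <;> assumption
    nlinarith
  have h3 := (norm_le_pi_norm (fun _ : Fin 1 => (|R| + 1) * s) 0).trans h2
  rw [Real.norm_eq_abs, abs_mul, hs, abs_of_nonneg (by positivity)] at h3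
  linarith [le_abs_self R]

/-! ### The wedge product -/

/-- The functionals defining the wedge product of a polygon and a segment. -/
def wedgeRow {p : ℕ} (a : ZMod p → Fin 2 → ℝ) (b : ZMod 2 → Fin 1 → ℝ) (k : ZMod p × ZMod 2) :
    ((Fin 2 → ℝ) × (ZMod p → Fin 1 → ℝ)) →ₗ[ℝ] ℝ where
  toFun z := a k.1 ⬝ᵥ z.1 + b k.2 ⬝ᵥ z.2 k.1
  map_add' z w := by
    simp only [Prod.fst_add, Prod.snd_add, Pi.add_apply, dotProduct_add]
    ring
  map_smul' s z := by
    simp only [Prod.smul_fst, Prod.smul_snd, Pi.smul_apply, dotProduct_smul, smul_eq_mul,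
      RingHom.id_apply]
    ring

/-- The index sets which contain both facets over an edge only for the edges in a flat. -/
def wedgeSets (p : ℕ) : Set (Set (ZMod p × ZMod 2)) :=
  {T | IsPolygonFlat {i | (i, 0) ∈ T ∧ (i, 1) ∈ T}}

theorem forall_zmod_two {P : ZMod 2 → Prop} : (∀ j, P j) ↔ P 0 ∧ P 1 :=
  Fin.forall_fin_two

theorem univ_notMem_wedgeSets {p : ℕ} (hp : 3 ≤ p) : univ ∉ wedgeSets p := by
  intro h
  refine not_isPolygonFlat_univ hp ?_
  simpa [wedgeSets] using h

/-- On a segment `[-L / |s|, L / r]` of length proportional to `L`, the tight ends can be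
prescribed, subject to both being tight exactly if `L = 0`. -/
theorem exists_tight_ends {r s L : ℝ} (hrs : r * s < 0) (hL : 0 ≤ L) {A B : Prop}
    (hAB : L = 0 ↔ A ∧ B) :
    ∃ y, r * y ≤ L ∧ s * y ≤ L ∧ (r * y = L ↔ A) ∧ (s * y = L ↔ B) := by
  have hr : r ≠ 0 := by rintro rfl; simp at hrs
  have hs : s ≠ 0 := by rintro rfl; simp at hrs
  have hr2 : 0 < r ^ 2 := by positivity
  have hs2 : 0 < s ^ 2 := by positivity
  have e1 : s / r < 0 := by
    rw [show s / r = r * s / r ^ 2 by field_simp]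
    exact div_neg_of_neg_of_pos hrs hr2
  have e2 : r / s < 0 := by
    rw [show r / s = r * s / s ^ 2 by field_simp]
    exact div_neg_of_neg_of_pos hrs hs2
  by_cases h0 : L = 0
  · have := hAB.1 h0
    exact ⟨0, by simp [h0, this.1, this.2]⟩
  have hL' : 0 < L := lt_of_le_of_ne hL (Ne.symm h0)
  by_cases hA : A
  · have hB : ¬ B := fun hB => h0 (hAB.2 ⟨hA, hB⟩)
    have e3 : r * (L / r) = L := by field_simp
    have e4 : s * (L / r) < 0 := by
      rw [show s * (L / r) = s / r * L by ring]
      exact mul_neg_of_neg_of_pos e1 hL'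
    exact ⟨L / r, e3.le, by linarith, by simp [e3, hA], by simp [hB]; linarith⟩
  · by_cases hB : B
    · have e3 : s * (L / s) = L := by field_simp
      have e4 : r * (L / s) < 0 := by
        rw [show r * (L / s) = r / s * L by ring]
        exact mul_neg_of_neg_of_pos e2 hL'
      exact ⟨L / s, by linarith, e3.le, by simp [hA]; linarith, by simp [e3, hB]⟩
    · exact ⟨0, by simpa, by simpa, by simp [hA]; linarith, by simp [hB]; linarith⟩

theorem both_tight_iff {r s y L : ℝ} (hrs : r * s < 0) (h1 : r * y ≤ L) (h2 : s * y ≤ L) :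
    0 ≤ L ∧ (r * y = L ∧ s * y = L ↔ L = 0) := by
  have hL : 0 ≤ L := by
    by_contra! hL
    rcases mul_neg_iff.1 hrs with ⟨hr, hs⟩ | ⟨hr, hs⟩ <;>
    rcases le_total 0 y with hy | hy <;> nlinarith
  refine ⟨hL, ?_, ?_⟩
  · rintro ⟨h3, h4⟩
    rcases mul_neg_iff.1 hrs with ⟨hr, hs⟩ | ⟨hr, hs⟩ <;>
    rcases le_total 0 y with hy | hy <;> nlinarith
  · rintro rfl
    have hy : y = 0 := by
      rcases mul_neg_iff.1 hrs with ⟨hr, hs⟩ | ⟨hr, hs⟩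
      · exact le_antisymm (nonpos_of_mul_nonpos_right h1 hr)
          (by by_contra! h; nlinarith)
      · exact le_antisymm (nonpos_of_mul_nonpos_right h2 hs)
          (by by_contra! h; nlinarith)
    simp [hy]

theorem activeSets_wedgeRow {p : ℕ} [NeZero p] (hp : 3 ≤ p) {a : ZMod p → Fin 2 → ℝ}
    {b : ZMod 2 → Fin 1 → ℝ} (ha : IsPolygonal fun i => slackCoeff (a i))
    (hb : b 0 0 * b 1 0 < 0) : activeSets (wedgeRow a b) = wedgeSets p := by
  have hrow : ∀ i j z, wedgeRow a b (i, j) z = a i ⬝ᵥ z.1 + b j 0 * z.2 i 0 := by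
    intro i j z
    simp [wedgeRow, dotProduct]
  ext T
  constructor
  · rintro ⟨z, hz, rfl⟩
    have key : ∀ i, 0 ≤ affEval (slackCoeff (a i)) z.1 ∧
        (wedgeRow a b (i, 0) z = 1 ∧ wedgeRow a b (i, 1) z = 1 ↔
          affEval (slackCoeff (a i)) z.1 = 0) := by
      intro i
      have h1 := hz (i, 0)
      have h2 := hz (i, 1)
      rw [hrow] at h1 h2
      rw [affEval_slackCoeff, hrow, hrow, ← eq_sub_iff_add_eq', ← eq_sub_iff_add_eq']
      exact both_tight_iff hb (by linarith) (by linarith)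
    have := ha.isPolygonFlat hp fun k => (key k).1
    simp only [← (key _).2] at this
    exact this
  · intro hT
    obtain ⟨x, hx, hx'⟩ := ha.exists_of_isPolygonFlat hp hT
    choose y hy using fun i => exists_tight_ends hb (hx i) (hx' i)
    simp only [affEval_slackCoeff] at hy
    refine ⟨(x, fun i _ => y i), ?_, ?_⟩
    · rintro ⟨i, j⟩
      rw [hrow]
      revert j
      rw [forall_zmod_two]
      exact ⟨by linarith [(hy i).1], by linarith [(hy i).2.1]⟩
    · ext ⟨i, j⟩
      rw [mem_ofPred_eq, hrow, ← eq_sub_iff_add_eq']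
      revert j
      rw [forall_zmod_two]
      exact ⟨(hy i).2.2.1.symm, (hy i).2.2.2.symm⟩

/-! ### The deformed wedge product -/

/-- The coordinates of the polygon plane. -/
def planeCoord (p : ℕ) : (Fin (2 + p) → ℝ) →ₗ[ℝ] (Fin 2 → ℝ) :=
  LinearMap.funLeft ℝ ℝ (Fin.castLE (Nat.le_add_right 2 p))

/-- The fibre coordinates in reversed order, indexed by `2, …, p + 1` and extended by `0`. -/
def fibreCoord (p n : ℕ) : (Fin (2 + p) → ℝ) →ₗ[ℝ] ℝ :=
  if h : 2 ≤ n ∧ n ≤ p + 1 then LinearMap.proj ⟨p + 3 - n, by omega⟩ else 0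

theorem fibreCoord_of_le {p n : ℕ} (h : 2 ≤ n) (h' : n ≤ p + 1) (z : Fin (2 + p) → ℝ) :
    fibreCoord p n z = z ⟨p + 3 - n, by omega⟩ := by
  simp [fibreCoord, h, h']

theorem fibreCoord_of_lt_two {p n : ℕ} (h : n < 2) (z : Fin (2 + p) → ℝ) :
    fibreCoord p n z = 0 := by
  simp [fibreCoord, Nat.not_le.2 h]

/-- The signs of the two ends of the segment `[-1, 1]`. -/
def endSign (j : ZMod 2) : ℝ := if j = 0 then 1 else -1

theorem abs_endSign (j : ZMod 2) : |endSign j| = 1 := by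
  unfold endSign
  split_ifs <;> simp

/-- The functionals defining the deformed wedge product. -/
def deformRow {p : ℕ} (a : ZMod p → Fin 2 → ℝ) (δ : ℝ) (k : ZMod p × ZMod 2) :
    (Fin (2 + p) → ℝ) →ₗ[ℝ] ℝ where
  toFun z := a k.1 ⬝ᵥ planeCoord p z + (endSign k.2 * fibreCoord p (k.1.val + 2) z -
    δ * fibreCoord p (k.1.val + 1) z + δ ^ 2 / 4 * fibreCoord p k.1.val z)
  map_add' z w := by
    simp only [map_add, dotProduct_add]
    ring
  map_smul' s z := by
    simp only [map_smul, dotProduct_smul, smul_eq_mul, RingHom.id_apply]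
    ring

theorem deformRow_apply {p : ℕ} (a : ZMod p → Fin 2 → ℝ) (δ : ℝ) (i : ZMod p) (j : ZMod 2)
    (z : Fin (2 + p) → ℝ) :
    deformRow a δ (i, j) z =
      a i ⬝ᵥ planeCoord p z + (endSign j * fibreCoord p (i.val + 2) z -
        δ * fibreCoord p (i.val + 1) z + δ ^ 2 / 4 * fibreCoord p i.val z) := rfl

/-- The fibre coordinates as affine functions on the plane, if each of them is the multiple
by `τ` of its maximal possible value. -/
def fibreCoeff {p : ℕ} (c : ZMod p → Fin 3 → ℝ) (δ : ℝ) (τ : ZMod p → ℝ) : ℕ → Fin 3 → ℝ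
  | 0 => 0
  | 1 => 0
  | n + 2 => τ n • (c n + δ • fibreCoeff c δ τ (n + 1) - (δ ^ 2 / 4) • fibreCoeff c δ τ n)

/-- The perturbed edge inequalities of the polygon. -/
def deformCoeff {p : ℕ} (c : ZMod p → Fin 3 → ℝ) (δ : ℝ) (τ : ZMod p → ℝ) (i : ZMod p) :
    Fin 3 → ℝ :=
  c i + δ • fibreCoeff c δ τ (i.val + 1) - (δ ^ 2 / 4) • fibreCoeff c δ τ i.val

theorem fibreCoeff_add_two {p : ℕ} [NeZero p] (c : ZMod p → Fin 3 → ℝ) (δ : ℝ) (τ : ZMod p → ℝ)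
    (i : ZMod p) : fibreCoeff c δ τ (i.val + 2) = τ i • deformCoeff c δ τ i := by
  simp [fibreCoeff, deformCoeff]

theorem affEval_smul (s : ℝ) (q : Fin 3 → ℝ) (x : Fin 2 → ℝ) :
    affEval (s • q) x = s * affEval q x := by
  simp [affEval]
  ring

theorem affEval_deformCoeff {p : ℕ} (c : ZMod p → Fin 3 → ℝ) (δ : ℝ) (τ : ZMod p → ℝ)
    (i : ZMod p) (x : Fin 2 → ℝ) :
    affEval (deformCoeff c δ τ i) x = affEval (c i) x +
      δ * affEval (fibreCoeff c δ τ (i.val + 1)) x -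
      δ ^ 2 / 4 * affEval (fibreCoeff c δ τ i.val) x := by
  simp [affEval, deformCoeff]
  ring

theorem continuous_fibreCoeff {p : ℕ} (c : ZMod p → Fin 3 → ℝ) (n : ℕ) :
    Continuous fun q : ℝ × (ZMod p → ℝ) => fibreCoeff c q.1 q.2 n := by
  induction n using Nat.twoStepInduction with
  | zero => exact continuous_const
  | one => exact continuous_const
  | more n h1 h2 =>
    simp only [fibreCoeff]
    fun_prop

theorem eventually_isPolygonal_deformCoeff {p : ℕ} [NeZero p] {c : ZMod p → Fin 3 → ℝ}
    (hc : IsPolygonal c) :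
    ∀ᶠ δ in nhds (0 : ℝ), ∀ τ ∈ Icc (-1 : ZMod p → ℝ) 1, IsPolygonal (deformCoeff c δ τ) := by
  refine isCompact_Icc.eventually_forall_of_forall_eventually fun τ _ => ?_
  have hcont : Continuous fun q : ℝ × (ZMod p → ℝ) => deformCoeff c q.1 q.2 := by
    refine continuous_pi fun i => ?_
    have h1 := continuous_fibreCoeff c (i.val + 1)
    have h2 := continuous_fibreCoeff c i.val
    unfold deformCoeff
    fun_prop
  refine hcont.continuousAt.eventually (isOpen_setOf_isPolygonal.mem_nhds ?_)
  have : deformCoeff c 0 τ = c := by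
    ext i
    simp [deformCoeff]
  simpa [this] using hc

theorem endSign_zero : endSign 0 = 1 := by simp [endSign]

theorem endSign_one : endSign 1 = -1 := by simp [endSign]

theorem activeSets_deformRow {p : ℕ} [NeZero p] (hp : 3 ≤ p) {a : ZMod p → Fin 2 → ℝ} {δ : ℝ}
    (h : ∀ τ ∈ Icc (-1 : ZMod p → ℝ) 1,
      IsPolygonal (deformCoeff (fun i => slackCoeff (a i)) δ τ)) :
    activeSets (deformRow a δ) = wedgeSets p := by
  have hsgn : endSign 0 * endSign 1 < 0 := by simp [endSign_zero, endSign_one]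
  obtain ⟨c, hc⟩ : ∃ c, c = fun i => slackCoeff (a i) := ⟨_, rfl⟩
  rw [← hc] at h
  have hsplit : ∀ (z : Fin (2 + p) → ℝ) (τ : ZMod p → ℝ),
      (∀ n, n < p + 2 → fibreCoord p n z = affEval (fibreCoeff c δ τ n) (planeCoord p z)) →
      ∀ i j, deformRow a δ (i, j) z = 1 - affEval (deformCoeff c δ τ i) (planeCoord p z) +
        endSign j * fibreCoord p (i.val + 2) z := by
    intro z τ hz i j
    have := ZMod.val_lt i
    rw [affEval_deformCoeff, ← hz _ (by omega), ← hz _ (by omega), deformRow_apply, hc,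
      affEval_slackCoeff]
    ring
  ext T
  constructor
  · rintro ⟨z, hz, rfl⟩
    obtain ⟨L, hL⟩ : ∃ L : ZMod p → ℝ, ∀ i, L i = 1 - a i ⬝ᵥ planeCoord p z +
      δ * fibreCoord p (i.val + 1) z - δ ^ 2 / 4 * fibreCoord p i.val z := ⟨_, fun _ => rfl⟩
    have hrow : ∀ i j, deformRow a δ (i, j) z = 1 - L i +
        endSign j * fibreCoord p (i.val + 2) z := by
      intro i j
      rw [hL, deformRow_apply]
      ring
    have hle : ∀ i j, endSign j * fibreCoord p (i.val + 2) z ≤ L i := by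
      intro i j
      have := hz (i, j)
      rw [hrow] at this
      linarith
    have hab : ∀ i, |fibreCoord p (i.val + 2) z| ≤ L i := by
      intro i
      have h0 := hle i 0
      have h1 := hle i 1
      rw [endSign_zero] at h0
      rw [endSign_one] at h1
      exact abs_le.2 ⟨by linarith, by linarith⟩
    have hL0 : ∀ i, 0 ≤ L i := fun i => (abs_nonneg _).trans (hab i)
    have hτ : (fun i => fibreCoord p (i.val + 2) z / L i) ∈ Icc (-1 : ZMod p → ℝ) 1 := by
      have : ∀ i, |fibreCoord p (i.val + 2) z / L i| ≤ 1 := by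
        intro i
        rw [abs_div, abs_of_nonneg (hL0 i)]
        exact div_le_one_of_le₀ (hab i) (hL0 i)
      exact ⟨fun i => (abs_le.1 (this i)).1, fun i => (abs_le.1 (this i)).2⟩
    obtain ⟨τ, hτe⟩ : ∃ τ : ZMod p → ℝ, τ = fun i => fibreCoord p (i.val + 2) z / L i := ⟨_, rfl⟩
    rw [← hτe] at hτ
    have hfib : ∀ n, n < p + 2 →
        fibreCoord p n z = affEval (fibreCoeff c δ τ n) (planeCoord p z) := by
      intro n
      induction n using Nat.twoStepInduction with
      | zero => exact fun _ => by simp [fibreCoord_of_lt_two, fibreCoeff, affEval]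
      | one => exact fun _ => by simp [fibreCoord_of_lt_two, fibreCoeff, affEval]
      | more n ih1 ih2 =>
        intro hn
        have hval : ((n : ZMod p)).val = n := ZMod.val_cast_of_lt (by omega)
        have h1 := fibreCoeff_add_two c δ τ (n : ZMod p)
        rw [hval] at h1
        have h2 : affEval (deformCoeff c δ τ n) (planeCoord p z) = L n := by
          rw [affEval_deformCoeff, hval, ← ih1 (by omega), ← ih2 (by omega), hL, hval, hc,
            affEval_slackCoeff]
        have h3 := hab n
        rw [h1, affEval_smul, h2, hτe]
        simp only [hval] at h3 ⊢
        by_cases h0 : L n = 0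
        · rw [h0] at h3 ⊢
          simpa using h3
        · field_simp
    have hLe : ∀ i, affEval (deformCoeff c δ τ i) (planeCoord p z) = L i := by
      intro i
      have := hsplit z τ hfib i 0
      rw [hrow] at this
      linarith
    have hflat := (h τ hτ).isPolygonFlat hp (x := planeCoord p z) fun i => (hLe i).symm ▸ hL0 i
    have hset : {i | (i, (0 : ZMod 2)) ∈ {k | deformRow a δ k z = 1} ∧
        (i, (1 : ZMod 2)) ∈ {k | deformRow a δ k z = 1}} =
        {i | affEval (deformCoeff c δ τ i) (planeCoord p z) = 0} := by
      ext i
      rw [mem_ofPred_eq, mem_ofPred_eq, mem_ofPred_eq, mem_ofPred_eq, hLe, hrow, hrow,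
        ← (both_tight_iff hsgn (hle i 0) (hle i 1)).2]
      constructor <;> rintro ⟨h1, h2⟩ <;> constructor <;> linarith
    change IsPolygonFlat _
    rw [hset]
    exact hflat
  · intro hT
    classical
    obtain ⟨τ, hτ⟩ : ∃ τ : ZMod p → ℝ, ∀ i, τ i =
      if (i, 0) ∈ T then (if (i, 1) ∈ T then 0 else 1) else (if (i, 1) ∈ T then -1 else 0) :=
      ⟨_, fun _ => rfl⟩
    have hτ' : τ ∈ Icc (-1 : ZMod p → ℝ) 1 := by
      refine ⟨fun i => ?_, fun i => ?_⟩ <;> simp only [hτ, Pi.neg_apply, Pi.one_apply] <;>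
        split_ifs <;> norm_num
    obtain ⟨x, hx, hx'⟩ := (h τ hτ').exists_of_isPolygonFlat hp hT
    obtain ⟨z, hz⟩ : ∃ z : Fin (2 + p) → ℝ, ∀ l, z l = if hl : l.val < 2 then x ⟨l.val, hl⟩
      else affEval (fibreCoeff c δ τ (p + 3 - l.val)) x := ⟨_, fun _ => rfl⟩
    have hplane : planeCoord p z = x := by
      ext l
      simp [planeCoord, LinearMap.funLeft_apply, hz, l.isLt]
    have hfib : ∀ n, n < p + 2 →
        fibreCoord p n z = affEval (fibreCoeff c δ τ n) (planeCoord p z) := by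
      intro n hn
      rw [hplane]
      match n with
      | 0 => simp [fibreCoord_of_lt_two, fibreCoeff, affEval]
      | 1 => simp [fibreCoord_of_lt_two, fibreCoeff, affEval]
      | n + 2 =>
        rw [fibreCoord_of_le (by omega) (by omega), hz, dif_neg (by simp only; omega)]
        simp only
        rw [show p + 3 - (p + 3 - (n + 2)) = n + 2 by omega]
    have hrow : ∀ i j, deformRow a δ (i, j) z = 1 +
        (endSign j * τ i - 1) * affEval (deformCoeff c δ τ i) x := by
      intro i j
      have := ZMod.val_lt i
      rw [hsplit z τ hfib, hfib _ (by omega), fibreCoeff_add_two, affEval_smul, hplane]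
      ring
    refine ⟨z, ?_, ?_⟩
    · rintro ⟨i, j⟩
      rw [hrow]
      have h1 := hx i
      have h2 : endSign j * τ i ≤ 1 := by
        refine (le_abs_self _).trans ?_
        rw [abs_mul, abs_endSign, one_mul]
        exact abs_le.2 ⟨hτ'.1 i, hτ'.2 i⟩
      nlinarith
    · ext ⟨i, j⟩
      rw [mem_ofPred_eq, hrow, add_eq_left, mul_eq_zero, hx', hτ]
      revert j
      rw [forall_zmod_two, endSign_zero, endSign_one]
      by_cases h0 : (i, (0 : ZMod 2)) ∈ T <;> by_cases h1 : (i, (1 : ZMod 2)) ∈ T <;>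
        simp [h0, h1] <;> norm_num

theorem exists_natCast_val_eq {p : ℕ} {n : ℕ} (hn : n < p) :
    ∃ i : ZMod p, i.val = n :=
  ⟨n, ZMod.val_cast_of_lt hn⟩

theorem fibreCoord_rev {p : ℕ} (m : ℕ) (hm : 2 + m < 2 + p) (z : Fin (2 + p) → ℝ) :
    fibreCoord p (p + 1 - m) z = z ⟨2 + m, hm⟩ := by
  rw [fibreCoord_of_le (by omega) (by omega)]
  congr 2
  omega

theorem isBounded_polyhedron_deformRow_zero {p : ℕ} [NeZero p] {a : ZMod p → Fin 2 → ℝ}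
    (hbd : Bornology.IsBounded {x | ∀ i, a i ⬝ᵥ x ≤ 1}) :
    Bornology.IsBounded (polyhedron (deformRow a 0)) := by
  obtain ⟨R, hR⟩ := hbd.exists_norm_le
  have hC : ∀ z ∈ polyhedron (deformRow a 0), ∀ i,
      |fibreCoord p (i.val + 2) z| ≤ 1 - a i ⬝ᵥ planeCoord p z := by
    intro z hz i
    have h0 := hz (i, 0)
    have h1 := hz (i, 1)
    rw [deformRow_apply, endSign_zero] at h0
    rw [deformRow_apply, endSign_one] at h1
    exact abs_le.2 ⟨by linarith, by linarith⟩
  have hplane : ∀ z ∈ polyhedron (deformRow a 0), ‖planeCoord p z‖ ≤ R := fun z hz =>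
    hR _ fun i => by linarith [(abs_nonneg _).trans (hC z hz i)]
  refine isBounded_iff_forall_norm_le.2
    ⟨|R| + ∑ i, (1 + (|a i 0| * |R| + |a i 1| * |R|)), fun z hz => ?_⟩
  have hx : ∀ l, |planeCoord p z l| ≤ |R| := fun l =>
    ((norm_le_pi_norm (planeCoord p z) l).trans (hplane z hz)).trans (le_abs_self R)
  have hnn : ∀ i, 0 ≤ 1 + (|a i 0| * |R| + |a i 1| * |R|) := fun i => by positivity
  have hsum : 0 ≤ ∑ i, (1 + (|a i 0| * |R| + |a i 1| * |R|)) :=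
    Finset.sum_nonneg fun i _ => hnn i
  refine (pi_norm_le_iff_of_nonneg (by positivity)).2 fun l => ?_
  rw [Real.norm_eq_abs]
  by_cases hl : l.val < 2
  · have h1 := hx ⟨l.val, hl⟩
    have h2 : planeCoord p z ⟨l.val, hl⟩ = z l := rfl
    rw [h2] at h1
    linarith
  · obtain ⟨l, hlp⟩ := l
    obtain ⟨m, rfl⟩ : ∃ m, l = 2 + m := ⟨l - 2, by grind⟩
    obtain ⟨i, hi⟩ := exists_natCast_val_eq (p := p) (n := p - 1 - m) (by omega)
    have h1 := hC z hz i
    rw [hi, show p - 1 - m + 2 = p + 1 - m by omega, fibreCoord_rev m hlp] at h1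
    have h2 : -(a i ⬝ᵥ planeCoord p z) ≤ |a i 0| * |R| + |a i 1| * |R| := by
      simp only [dotProduct, Fin.sum_univ_two]
      have h3 := mul_le_mul_of_nonneg_left (hx 0) (abs_nonneg (a i 0))
      have h4 := mul_le_mul_of_nonneg_left (hx 1) (abs_nonneg (a i 1))
      rw [← abs_mul] at h3 h4
      linarith [neg_abs_le (a i 0 * planeCoord p z 0), neg_abs_le (a i 1 * planeCoord p z 1)]
    have h5 := Finset.single_le_sum (f := fun i => 1 + (|a i 0| * |R| + |a i 1| * |R|))
      (fun i _ => hnn i) (Finset.mem_univ i)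
    linarith [abs_nonneg R]

theorem eventually_isBounded_polyhedron_deformRow {p : ℕ} [NeZero p] {a : ZMod p → Fin 2 → ℝ}
    (hbd : Bornology.IsBounded {x | ∀ i, a i ⬝ᵥ x ≤ 1}) :
    ∀ᶠ δ in nhds (0 : ℝ), Bornology.IsBounded (polyhedron (deformRow a δ)) := by
  obtain ⟨R, hR⟩ := (isBounded_polyhedron_deformRow_zero hbd).exists_norm_le
  have hcont : ∀ k, Continuous fun q : ℝ × (Fin (2 + p) → ℝ) => deformRow a q.1 k q.2 := by
    rintro ⟨i, j⟩
    have h1 : ∀ n, Continuous (fibreCoord p n) := fun n =>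
      LinearMap.continuous_of_finiteDimensional _
    have h2 : Continuous (planeCoord p) := LinearMap.continuous_of_finiteDimensional _
    simp only [deformRow_apply, dotProduct, Fin.sum_univ_two]
    fun_prop
  have hev : ∀ᶠ δ in nhds (0 : ℝ), ∀ z ∈ Metric.sphere (0 : Fin (2 + p) → ℝ) (|R| + 1),
      ∃ k, 1 < deformRow a δ k z := by
    refine (isCompact_sphere _ _).eventually_forall_of_forall_eventually fun z hz => ?_
    obtain ⟨k, hk⟩ : ∃ k, 1 < deformRow a 0 k z := by
      by_contra! hcon
      have h1 := hR z hcon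
      rw [mem_sphere_zero_iff_norm.1 hz] at h1
      linarith [le_abs_self R]
    filter_upwards [((hcont k).tendsto (0, z)).eventually_const_lt hk] with q hq
    exact ⟨k, hq⟩
  filter_upwards [hev] with δ hδ
  refine isBounded_iff_forall_norm_le.2 ⟨|R| + 1, fun z hz => ?_⟩
  by_contra! hlt
  have hpos : 0 < |R| + 1 := by positivity
  have hz0 : 0 < ‖z‖ := hpos.trans hlt
  obtain ⟨k, hk⟩ := hδ (((|R| + 1) / ‖z‖) • z) <| by
    rw [mem_sphere_zero_iff_norm, norm_smul, Real.norm_of_nonneg (by positivity)]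
    field_simp
  rw [map_smul, smul_eq_mul] at hk
  have h1 : (|R| + 1) / ‖z‖ < 1 := (div_lt_one hz0).2 hlt
  have h2 : 0 < (|R| + 1) / ‖z‖ := by positivity
  have h3 := hz k
  nlinarith

/-! ### Supporting functionals of the projected surface -/

/-- The positive multipliers of the facet normals at a surface polygon. -/
def multiplier (δ : ℝ) (σ : ℕ → ℝ) : ℕ → ℝ
  | 0 => 1
  | 1 => 2 / δ
  | n + 2 => (δ * multiplier δ σ (n + 1) - σ n * multiplier δ σ n) / (δ ^ 2 / 4)

theorem multiplier_pos_and_le {δ : ℝ} (hδ : 0 < δ) {σ : ℕ → ℝ} (hσ : ∀ n, |σ n| = 1) (n : ℕ) :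
    0 < multiplier δ σ n ∧ 2 * multiplier δ σ n ≤ δ * multiplier δ σ (n + 1) := by
  induction n with
  | zero =>
    refine ⟨one_pos, le_of_eq ?_⟩
    simp only [multiplier]
    field_simp
  | succ n ih =>
    obtain ⟨h1, h2⟩ := ih
    have h3 : 0 < multiplier δ σ (n + 1) := pos_of_mul_pos_right (by linarith) hδ.le
    refine ⟨h3, ?_⟩
    have h4 : δ * multiplier δ σ (n + 1 + 1) =
        4 * (δ * multiplier δ σ (n + 1) - σ n * multiplier δ σ n) / δ := by
      simp only [multiplier]
      field_simp
    have h5 : σ n * multiplier δ σ n ≤ multiplier δ σ n := by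
      have := (le_abs_self (σ n)).trans (hσ n).le
      nlinarith
    rw [h4, le_div_iff₀ hδ]
    nlinarith

theorem sum_multiplier_mul (δ : ℝ) (hδ : 0 < δ) (σ t : ℕ → ℝ) (h0 : t 0 = 0) (h1 : t 1 = 0)
    (N : ℕ) :
    ∑ n ∈ Finset.range (N + 2),
        multiplier δ σ n * (σ n * t (n + 2) - δ * t (n + 1) + δ ^ 2 / 4 * t n) =
      (σ N * multiplier δ σ N - δ * multiplier δ σ (N + 1)) * t (N + 2) +
        σ (N + 1) * multiplier δ σ (N + 1) * t (N + 3) := by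
  induction N with
  | zero =>
    rw [Finset.sum_range_succ, Finset.sum_range_one, h0, h1]
    ring
  | succ N ih =>
    rw [Finset.sum_range_succ, ih]
    have h2 : multiplier δ σ (N + 2) * (δ ^ 2 / 4) =
        δ * multiplier δ σ (N + 1) - σ N * multiplier δ σ N := by
      simp only [multiplier]
      field_simp
    linear_combination t (N + 2) * h2

theorem sum_zmod_val {p : ℕ} [NeZero p] (g : ℕ → ℝ) :
    ∑ i : ZMod p, g i.val = ∑ n ∈ Finset.range p, g n :=
  Finset.sum_nbij' ZMod.val (fun n => (n : ZMod p)) (fun i _ => Finset.mem_range.2 (ZMod.val_lt i))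
    (fun _ _ => Finset.mem_univ _) (fun i _ => ZMod.natCast_zmod_val i)
    (fun _ hn => ZMod.val_cast_of_lt (Finset.mem_range.1 hn)) (fun _ _ => rfl)

theorem exists_lower_functional {p : ℕ} [NeZero p] (hp : 3 ≤ p) (a : ZMod p → Fin 2 → ℝ) {δ : ℝ}
    (hδ : 0 < δ) (κ : ZMod p → ZMod 2) :
    ∃ (c : Fin 4 → ℝ) (w : ZMod p → ℝ), c 3 < 0 ∧ (∀ i, 0 < w i) ∧
      ∀ z : Fin (2 + p) → ℝ, (c ⬝ᵥ fun l => z (Fin.castLE (by omega) l)) =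
        ∑ i, w i * deformRow a δ (i, κ i) z := by
  obtain ⟨N, rfl⟩ : ∃ N, p = N + 2 := ⟨p - 2, by omega⟩
  obtain ⟨σ, hσ⟩ : ∃ σ : ℕ → ℝ, σ = fun n : ℕ => endSign (κ (n : ZMod (N + 2))) := ⟨_, rfl⟩
  have hσ1 : ∀ n, |σ n| = 1 := fun n => by rw [hσ]; exact abs_endSign _
  have hm := multiplier_pos_and_le hδ hσ1
  refine ⟨![∑ i : ZMod (N + 2), multiplier δ σ i.val * a i 0,
    ∑ i : ZMod (N + 2), multiplier δ σ i.val * a i 1,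
    σ (N + 1) * multiplier δ σ (N + 1), σ N * multiplier δ σ N - δ * multiplier δ σ (N + 1)],
    fun i => multiplier δ σ i.val, ?_, fun i => (hm _).1, fun z => ?_⟩
  · change σ N * multiplier δ σ N - δ * multiplier δ σ (N + 1) < 0
    have h1 := (le_abs_self (σ N)).trans (hσ1 N).le
    have h2 := hm N
    nlinarith
  · have h1 : ∀ i : ZMod (N + 2), multiplier δ σ i.val * deformRow a δ (i, κ i) z =
        multiplier δ σ i.val * a i 0 * planeCoord (N + 2) z 0 +
        multiplier δ σ i.val * a i 1 * planeCoord (N + 2) z 1 +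
        multiplier δ σ i.val * (σ i.val * fibreCoord (N + 2) (i.val + 2) z -
          δ * fibreCoord (N + 2) (i.val + 1) z + δ ^ 2 / 4 * fibreCoord (N + 2) i.val z) := by
      intro i
      rw [deformRow_apply, hσ]
      simp only [dotProduct, Fin.sum_univ_two, ZMod.natCast_zmod_val]
      ring
    have h2 := sum_zmod_val (p := N + 2) fun n => multiplier δ σ n *
      (σ n * fibreCoord (N + 2) (n + 2) z -
          δ * fibreCoord (N + 2) (n + 1) z + δ ^ 2 / 4 * fibreCoord (N + 2) n z)
    have h3 := sum_multiplier_mul δ hδ σ (fun n => fibreCoord (N + 2) n z)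
      (fibreCoord_of_lt_two (by norm_num) z) (fibreCoord_of_lt_two (by norm_num) z) N
    rw [Finset.sum_congr rfl fun i _ => h1 i, Finset.sum_add_distrib, Finset.sum_add_distrib,
      ← Finset.sum_mul, ← Finset.sum_mul, h2, h3]
    have e2 : fibreCoord (N + 2) (N + 3) z = z (Fin.castLE (by omega) (2 : Fin 4)) :=
      fibreCoord_rev 0 (by omega) z
    have e3 : fibreCoord (N + 2) (N + 2) z = z (Fin.castLE (by omega) (3 : Fin 4)) :=
      fibreCoord_rev 1 (by omega) z
    rw [e2, e3]
    simp only [dotProduct, Fin.sum_univ_four]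
    change _ * planeCoord (N + 2) z 0 + _ * planeCoord (N + 2) z 1 + _ + _ = _
    simp only [Matrix.cons_val]
    ring

theorem eq_zero_of_deformRow_eq_zero {p : ℕ} [NeZero p] (hp : 3 ≤ p) {a : ZMod p → Fin 2 → ℝ}
    {δ : ℝ} (hδ : 0 < δ) {κ : ZMod p → ZMod 2} {z : Fin (2 + p) → ℝ}
    (hz : ∀ l : Fin (2 + p), l.val < 4 → z l = 0)
    (hrow : ∀ i, deformRow a δ (i, κ i) z = 0) : z = 0 := by
  have hplane : planeCoord p z = 0 := by
    ext l
    exact hz _ (by simp; omega)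
  have hfib : ∀ m, m ≤ p → fibreCoord p (p + 1 - m) z = 0 ∧ fibreCoord p (p - m) z = 0 := by
    intro m
    induction m with
    | zero =>
      intro _
      refine ⟨(fibreCoord_rev 0 (by omega) z).trans (hz _ (by simp)), ?_⟩
      exact (fibreCoord_rev 1 (by omega) z).trans (hz _ (by simp))
    | succ m ih =>
      intro hm
      obtain ⟨h1, h2⟩ := ih (by omega)
      obtain ⟨i, hi⟩ := exists_natCast_val_eq (p := p) (n := p - (m + 1)) (by omega)
      have h3 := hrow i
      rw [deformRow_apply, hi, hplane, show p - (m + 1) + 2 = p + 1 - m by omega, h1,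
        show p - (m + 1) + 1 = p - m by omega, h2] at h3
      have h4 : δ ^ 2 / 4 ≠ 0 := by positivity
      refine ⟨by rwa [show p + 1 - (m + 1) = p - m by omega], ?_⟩
      simpa [h4] using h3
  ext ⟨l, hl⟩
  by_cases hl4 : l < 4
  · exact hz _ hl4
  · obtain ⟨m, rfl⟩ : ∃ m, l = 2 + m := ⟨l - 2, by omega⟩
    exact (fibreCoord_rev m hl z).symm.trans (hfib m (by omega)).1

/-- A nonnegative combination of inequalities with positive weights is tight exactly if all of
the inequalities are. -/
theorem sum_mul_le_and_eq_iff {ι : Type*} (s : Finset ι) {w v : ι → ℝ}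
    (hw : ∀ i ∈ s, 0 < w i) (hv : ∀ i ∈ s, v i ≤ 1) :
    ∑ i ∈ s, w i * v i ≤ ∑ i ∈ s, w i ∧
      (∑ i ∈ s, w i * v i = ∑ i ∈ s, w i ↔ ∀ i ∈ s, v i = 1) := by
  have hle : ∀ i ∈ s, w i * v i ≤ w i := fun i hi => by
    simpa using mul_le_mul_of_nonneg_left (hv i hi) (hw i hi).le
  refine ⟨Finset.sum_le_sum hle, ?_⟩
  rw [Finset.sum_eq_sum_iff_of_le hle]
  refine forall₂_congr fun i hi => ?_
  simp [(hw i hi).ne']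

theorem convex_polyhedron {I V : Type*} [AddCommGroup V] [Module ℝ V] (f : I → V →ₗ[ℝ] ℝ) :
    Convex ℝ (polyhedron f) := by
  have : polyhedron f = ⋂ i, {z | f i z ≤ 1} := by
    ext z
    simp [polyhedron]
  rw [this]
  exact convex_iInter fun i => convex_halfSpace_le (f i).isLinear 1

theorem isClosed_polyhedron {I : Type*} {n : ℕ} (f : I → (Fin n → ℝ) →ₗ[ℝ] ℝ) :
    IsClosed (polyhedron f) := by
  have : polyhedron f = ⋂ i, {z | f i z ≤ 1} := by
    ext z
    simp [polyhedron]
  rw [this]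
  exact isClosed_iInter fun i =>
    isClosed_le (LinearMap.continuous_of_finiteDimensional _) continuous_const

/-- A linear map which is injective on differences of points of `S` has an affine inverse
there. -/
theorem exists_affine_inverse {I V U : Type*} [AddCommGroup V] [Module ℝ V] [AddCommGroup U]
    [Module ℝ U] (π : V →ₗ[ℝ] U) (g : I → V →ₗ[ℝ] ℝ)
    (hinj : ∀ z, π z = 0 → (∀ i, g i z = 0) → z = 0) :
    ∃ r : U →ₗ[ℝ] V, ∀ z, (∀ i, g i z = 0) → r (π z) = z := by
  let K : Submodule ℝ V := ⨅ i, LinearMap.ker (g i)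
  have hK : ∀ z, z ∈ K ↔ ∀ i, g i z = 0 := fun z => by simp [K]
  obtain ⟨r, hr⟩ := (π ∘ₗ K.subtype).exists_leftInverse_of_injective <| by
    rw [LinearMap.ker_eq_bot']
    rintro ⟨z, hz⟩ h
    exact Subtype.ext (hinj z h ((hK z).1 hz))
  refine ⟨K.subtype ∘ₗ r, fun z hz => ?_⟩
  exact congrArg Subtype.val (LinearMap.congr_fun hr ⟨z, (hK z).2 hz⟩)

/-- Every surface face has a supporting functional, factoring through the projection, with
negative last coordinate. -/
theorem exists_lower_support {p : ℕ} [NeZero p] (hp : 3 ≤ p) (a : ZMod p → Fin 2 → ℝ) {δ : ℝ}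
    (hδ : 0 < δ) {T : Set (ZMod p × ZMod 2)} {κ : ZMod p → ZMod 2} (hκ : ∀ i, (i, κ i) ∈ T) :
    ∃ (c : Fin 4 → ℝ) (β : ℝ), c 3 < 0 ∧ ∀ z ∈ polyhedron (deformRow a δ),
      (c ⬝ᵥ fun l => z (Fin.castLE (by omega) l)) ≤ β ∧
      ((c ⬝ᵥ fun l => z (Fin.castLE (by omega) l)) = β ↔ z ∈ tightFace (deformRow a δ) T) := by
  classical
  choose c w hc hw hcw using fun κ => exists_lower_functional hp a hδ κ
  obtain ⟨K, hK⟩ : ∃ K : Finset (ZMod p → ZMod 2), ∀ κ, κ ∈ K ↔ ∀ i, (i, κ i) ∈ T :=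
    ⟨Finset.univ.filter fun κ : ZMod p → ZMod 2 => ∀ i, (i, κ i) ∈ T, fun κ => by simp⟩
  refine ⟨∑ κ ∈ K, c κ, ∑ κ ∈ K, ∑ i, w κ i, ?_, fun z hz => ?_⟩
  · rw [Finset.sum_apply]
    exact Finset.sum_neg (fun κ _ => hc κ) ⟨κ, (hK κ).2 hκ⟩
  · have hone := fun κ => sum_mul_le_and_eq_iff Finset.univ (w := w κ)
      (v := fun i => deformRow a δ (i, κ i) z) (fun i _ => hw κ i) (fun i _ => hz _)
    rw [sum_dotProduct]
    simp only [hcw]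
    refine ⟨Finset.sum_le_sum fun κ _ => (hone κ).1, ?_⟩
    rw [Finset.sum_eq_sum_iff_of_le fun κ _ => (hone κ).1]
    constructor
    · intro h
      refine ⟨hz, ?_⟩
      rintro ⟨i, j⟩ hij
      have hmem : Function.update κ i j ∈ K := (hK _).2 fun k => by
        by_cases hk : k = i
        · subst hk
          simpa using hij
        · simpa [hk] using hκ k
      simpa using (hone _).2.1 (h _ hmem) i (Finset.mem_univ i)
    · exact fun h κ hmem => (hone κ).2.2 fun i _ => h.2 _ ((hK κ).1 hmem i)

/-- For every `p ≥ 3` the wedge product `W_{p,1} = C_p ⋈ Δ_1`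
admits a realization `W'` in `ℝ^{2+p}` such that all the faces corresponding to the
surface `Σ_{p,4} ⊂ W_{p,1}` (the `p`-gon faces `(j̄_0, …, j̄_{p-1})` and their subfaces)
are preserved by the projection to the first four coordinates and lie on the lower hull
of the projected `4`-polytope with respect to the fourth coordinate; hence `Σ_{p,4}` is
realized as a subcomplex of the boundary of a `4`-polytope in `ℝ⁴` and, by orthogonal
projection to the first three coordinates, as an embedded polyhedral surface
in `ℝ³`. -/
theorem surface_pq4_projection_realization
    (p : ℕ) [NeZero p] (hp : 3 ≤ p)
    -- the `p`-gon `C_p`: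
    (a : ZMod p → Fin 2 → ℝ)
    (C : Set (Fin 2 → ℝ)) (hC : C = {x | ∀ i, a i ⬝ᵥ x ≤ 1})
    (hCbd : Bornology.IsBounded C) (hCdim : setDim C = 2)
    (hCfacets : ∀ i, IsFacetOf {x ∈ C | a i ⬝ᵥ x = 1} C)
    (hCinj : Function.Injective fun i => {x ∈ C | a i ⬝ᵥ x = 1})
    (hCall : ∀ G, IsFacetOf G C → ∃ i, G = {x ∈ C | a i ⬝ᵥ x = 1})
    (hCcyc : ∀ i i' : ZMod p,
      (∃ v, {x ∈ C | a i ⬝ᵥ x = 1} ∩ {x ∈ C | a i' ⬝ᵥ x = 1} = {v}) ↔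
        (i' = i + 1 ∨ i = i' + 1))
    -- the `1`-simplex (segment) `Δ_1`:
    (b : ZMod 2 → Fin 1 → ℝ)
    (Δ : Set (Fin 1 → ℝ)) (hΔ : Δ = {y | ∀ j, b j ⬝ᵥ y ≤ 1})
    (hΔbd : Bornology.IsBounded Δ) (hΔdim : setDim Δ = 1)
    (hΔfacets : ∀ j, IsFacetOf {y ∈ Δ | b j ⬝ᵥ y = 1} Δ)
    (hΔinj : Function.Injective fun j => {y ∈ Δ | b j ⬝ᵥ y = 1})
    (hΔall : ∀ G, IsFacetOf G Δ → ∃ j, G = {y ∈ Δ | b j ⬝ᵥ y = 1})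
    -- the wedge product `W = W_{p,1} = C_p ⋈ Δ_1`:
    (W : Set ((Fin 2 → ℝ) × (ZMod p → Fin 1 → ℝ)))
    (hW : W = {z | ∀ i j, a i ⬝ᵥ z.1 + b j ⬝ᵥ z.2 i ≤ 1})
    -- the `p`-gon faces of `W`, all of which belong to `Σ_{p,4}`:
    (G : (ZMod p → ZMod 2) → Set ((Fin 2 → ℝ) × (ZMod p → Fin 1 → ℝ)))
    (hG : ∀ jv, G jv =
      {z ∈ W | ∀ i, ∀ j', j' ≠ jv i → a i ⬝ᵥ z.1 + b j' ⬝ᵥ z.2 i = 1})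
    -- the projections to the first four resp. first three coordinates:
    (π₄ : (Fin (2 + p) → ℝ) → (Fin 4 → ℝ))
    (hπ₄ : π₄ = fun x l => x (Fin.castLE (by omega) l))
    (π₃ : (Fin (2 + p) → ℝ) → (Fin 3 → ℝ))
    (hπ₃ : π₃ = fun x l => x (Fin.castLE (by omega) l)) :
    ∃ (W' : Set (Fin (2 + p) → ℝ))
      (e : {F // IsFaceOf F W} ≃o {F' // IsFaceOf F' W'}),
      -- `W'` is a realization of `W_{p,1}` in `ℝ^{2+p}`:
      Bornology.IsBounded W' ∧ Convex ℝ W' ∧ IsClosed W' ∧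
      -- every face of the surface is preserved by `π₄` and its image lies on the
      -- lower hull of the `4`-polytope `π₄(W')`:
      (∀ (F : Set ((Fin 2 → ℝ) × (ZMod p → Fin 1 → ℝ))) (hF : IsFaceOf F W),
        F.Nonempty → (∃ jv, F ⊆ G jv) →
        ((IsFaceOf (π₄ '' (e ⟨F, hF⟩).1) (π₄ '' W') ∧
          Nonempty ({X // IsFaceOf X (e ⟨F, hF⟩).1} ≃o
            {X // IsFaceOf X (π₄ '' (e ⟨F, hF⟩).1)}) ∧
          π₄ ⁻¹' (π₄ '' (e ⟨F, hF⟩).1) ∩ W' = (e ⟨F, hF⟩).1) ∧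
        (∃ (c : Fin 4 → ℝ) (β : ℝ), c 3 < 0 ∧
          (∀ z ∈ π₄ '' W', c ⬝ᵥ z ≤ β) ∧
          π₄ '' (e ⟨F, hF⟩).1 = {z ∈ π₄ '' W' | c ⬝ᵥ z = β}))) ∧
      -- the orthogonal projection to the first three coordinates embeds the surface:
      Set.InjOn π₃
        (⋃₀ {S | ∃ (F : Set ((Fin 2 → ℝ) × (ZMod p → Fin 1 → ℝ)))
            (hF : IsFaceOf F W), F.Nonempty ∧ (∃ jv, F ⊆ G jv) ∧
            S = (e ⟨F, hF⟩).1}) := by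
  have ha := isPolygonal_slackCoeff hp a C hC hCbd hCdim hCinj hCcyc
  have hb := mul_neg_of_isBounded_segment b (hΔ ▸ hΔbd)
  obtain rfl : W = polyhedron (wedgeRow a b) := by
    rw [hW]
    ext z
    exact ⟨fun h k => h k.1 k.2, fun h i j => h (i, j)⟩
  obtain ⟨δ, ⟨hpoly, hbdd⟩, hδ⟩ :=
    (((eventually_isPolygonal_deformCoeff ha).and
      (eventually_isBounded_polyhedron_deformRow (hC ▸ hCbd))).filter_mono
        nhdsWithin_le_nhds |>.and (self_mem_nhdsWithin (s := Ioi (0 : ℝ)))).exists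
  have hδ : 0 < δ := hδ
  have hAW := activeSets_wedgeRow hp ha hb
  have hAW' := activeSets_deformRow hp hpoly
  have huniv : univ ∉ activeSets (wedgeRow a b) := hAW ▸ univ_notMem_wedgeSets hp
  let L : (Fin (2 + p) → ℝ) →ₗ[ℝ] (Fin 4 → ℝ) :=
    LinearMap.funLeft ℝ ℝ (Fin.castLE (by omega))
  obtain rfl : π₄ = L := hπ₄
  have hlow : ∀ l : Fin (2 + p), l.val < 4 → ∀ z, L z = 0 → z l = 0 :=
    fun l hl z hz => congrFun hz ⟨l.val, hl⟩
  -- every nonempty surface face contains all the facets of some surface polygon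
  have hκ : ∀ F : Set ((Fin 2 → ℝ) × (ZMod p → Fin 1 → ℝ)), (∃ jv, F ⊆ G jv) →
      ∃ κ : ZMod p → ZMod 2, ∀ i, (i, κ i) ∈ tightIndices (wedgeRow a b) F := by
    rintro F ⟨jv, hF⟩
    refine ⟨fun i => jv i + 1, fun i z hz => ?_⟩
    have h1 := hF hz
    rw [hG] at h1
    exact h1.2 i _ (by simp)
  refine ⟨polyhedron (deformRow a δ), faceIso _ _ (hAW.trans hAW'.symm) huniv, hbdd,
    convex_polyhedron _, isClosed_polyhedron _, ?_, ?_⟩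
  · intro F hF hne hFG
    obtain ⟨κ, hκF⟩ := hκ F hFG
    obtain ⟨c, β, hc, hsupp⟩ := exists_lower_support hp a hδ hκF
    change ((IsFaceOf (L '' tightFace (deformRow a δ) (tightIndices (wedgeRow a b) F)) _ ∧
      Nonempty ({X // IsFaceOf X (tightFace (deformRow a δ) (tightIndices (wedgeRow a b) F))} ≃o
        {X // IsFaceOf X (L '' tightFace (deformRow a δ) (tightIndices (wedgeRow a b) F))}) ∧
      L ⁻¹' (L '' tightFace (deformRow a δ) (tightIndices (wedgeRow a b) F)) ∩ _ =
        tightFace (deformRow a δ) (tightIndices (wedgeRow a b) F)) ∧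
      ∃ (c : Fin 4 → ℝ) (β : ℝ), c 3 < 0 ∧
        (∀ z ∈ L '' polyhedron (deformRow a δ), c ⬝ᵥ z ≤ β) ∧
        L '' tightFace (deformRow a δ) (tightIndices (wedgeRow a b) F) = _)
    obtain ⟨E, hE⟩ : ∃ E, E = tightFace (deformRow a δ) (tightIndices (wedgeRow a b) F) :=
      ⟨_, rfl⟩
    rw [← hE] at hsupp ⊢
    have hsub : E ⊆ polyhedron (deformRow a δ) := hE ▸ fun z hz => hz.1
    have hsupp' : ∀ z ∈ polyhedron (deformRow a δ), c ⬝ᵥ L z ≤ β ∧ (c ⬝ᵥ L z = β ↔ z ∈ E) :=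
      hsupp
    have himg : L '' E = {z ∈ L '' polyhedron (deformRow a δ) | c ⬝ᵥ z = β} := by
      ext y
      constructor
      · rintro ⟨z, hz, rfl⟩
        exact ⟨⟨z, hsub hz, rfl⟩, (hsupp' z (hsub hz)).2.2 hz⟩
      · rintro ⟨⟨z, hz, rfl⟩, hy⟩
        exact ⟨z, (hsupp' z hz).2.1 hy, rfl⟩
    have hle : ∀ z ∈ L '' polyhedron (deformRow a δ), c ⬝ᵥ z ≤ β := by
      rintro _ ⟨z, hz, rfl⟩
      exact (hsupp' z hz).1
    refine ⟨⟨⟨image_mono hsub, dotProductBilin ℝ ℝ c, β, hle, himg⟩, ?_, ?_⟩, c, β, hc, hle, himg⟩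
    · rcases E.eq_empty_or_nonempty with h0 | ⟨z₀, hz₀⟩
      · rw [h0, image_empty]
        exact ⟨imageFaceIso L 0 ∅ 0 (by simp) |>.trans
          (OrderIso.setCongr _ _ (by rw [image_empty]))⟩
      · obtain ⟨r, hr⟩ := exists_affine_inverse L (fun i => deformRow a δ (i, κ i))
          fun z hz hrow => eq_zero_of_deformRow_eq_zero hp hδ (fun l hl => hlow l hl z hz) hrow
        refine ⟨imageFaceIso L r E z₀ fun z hz => ?_⟩
        rw [← map_sub]
        refine hr _ fun i => ?_
        rw [hE] at hz hz₀
        rw [map_sub, hz.2 _ (hκF i), hz₀.2 _ (hκF i), sub_self]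
    · refine Subset.antisymm ?_ fun z hz => ⟨⟨z, hz, rfl⟩, hsub hz⟩
      rintro z ⟨⟨w, hw, hwz⟩, hz⟩
      rw [← (hsupp' z hz).2, ← hwz]
      exact (hsupp' w (hsub hw)).2.2 hw
  · -- of two surface points with the same image in space neither lies above the other
    have hsurf : ∀ z ∈ ⋃₀ {S | ∃ (F : Set ((Fin 2 → ℝ) × (ZMod p → Fin 1 → ℝ)))
        (hF : IsFaceOf F (polyhedron (wedgeRow a b))), F.Nonempty ∧ (∃ jv, F ⊆ G jv) ∧
        S = (faceIso (wedgeRow a b) (deformRow a δ) (hAW.trans hAW'.symm) huniv ⟨F, hF⟩).1},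
        ∃ κ : ZMod p → ZMod 2, z ∈ tightFace (deformRow a δ) {k | k.2 = κ k.1} := by
      rintro z ⟨_, ⟨F, hF, -, hFG, rfl⟩, hz⟩
      obtain ⟨κ, hκF⟩ := hκ F hFG
      refine ⟨κ, tightFace_anti _ ?_ hz⟩
      rintro ⟨i, j⟩ hij
      obtain rfl : j = κ i := hij
      exact hκF i
    have hordered : ∀ z w : Fin (2 + p) → ℝ, ∀ κ : ZMod p → ZMod 2,
        z ∈ tightFace (deformRow a δ) {k | k.2 = κ k.1} → w ∈ polyhedron (deformRow a δ) →
        π₃ z = π₃ w → L w 3 ≤ L z 3 → z = w := by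
      intro z w κ hz hw hzw h3
      obtain ⟨c, β, hc, hsupp⟩ :=
        exists_lower_support hp a hδ (T := {k | k.2 = κ k.1}) (κ := κ) fun i => rfl
      have h0 : ∀ l : Fin 3, z (Fin.castLE (by omega) l) = w (Fin.castLE (by omega) l) := by
        rw [hπ₃] at hzw
        exact congrFun hzw
      have e0 : L z 0 = L w 0 := h0 0
      have e1 : L z 1 = L w 1 := h0 1
      have e2 : L z 2 = L w 2 := h0 2
      have hz' : c ⬝ᵥ L z = β := (hsupp z hz.1).2.2 hz
      have hw' : c ⬝ᵥ L w ≤ β := (hsupp w hw).1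
      simp only [dotProduct, Fin.sum_univ_four] at hz' hw'
      have e3 : L z 3 = L w 3 := by
        rw [e0, e1, e2] at hz'
        nlinarith
      have hL : L z = L w := by
        ext l
        fin_cases l
        exacts [e0, e1, e2, e3]
      have hwT := (hsupp w hw).2.1 (by
        change c ⬝ᵥ L w = β
        rw [← hL]
        exact (hsupp z hz.1).2.2 hz)
      refine sub_eq_zero.1 (eq_zero_of_deformRow_eq_zero hp hδ (a := a) (κ := κ)
        (fun l hl => hlow l hl _ (by rw [map_sub, hL, sub_self])) fun i => ?_)
      rw [map_sub, hz.2 _ rfl, hwT.2 _ rfl, sub_self]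
    intro z hz w hw hzw
    obtain ⟨κ, hzκ⟩ := hsurf z hz
    obtain ⟨κ', hwκ⟩ := hsurf w hw
    rcases le_total (L w 3) (L z 3) with h | h
    · exact hordered z w κ hzκ hwκ.1 hzw h
    · exact (hordered w z κ' hwκ hzκ.1 hzw.symm h).symm
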